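/- Let X_1, X_2, … be a sequence of i.i.d. random variables with values in [0,1] and mean μ, and let μ̂_n = (1/n) Σ_{i=1}^n X_i. Then for all integers K ≥ 1 and τ ≥ K, E[ sup_{n ≥ 1} ( μ − μ̂_n − √( (1/(2n)) ln_+( τ/(Kn) ) ) )⁺ ] ≤ 20 √(π/8) · √(K/τ), where (x)⁺ = max(x, 0) and ln_+ = max(ln, 0). -/

import Mathlib

open MeasureTheory ProbabilityTheory Real ENNReal
open scoped Classical

/-- Ville-type inequality for products of independent nonnegative mean-one variables. -/
lemma ville_prod {Ω : Type*} [mΩ : MeasurableSpace Ω]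
    (P : Measure Ω) [IsProbabilityMeasure P] (Z : ℕ → Ω → ℝ)
    (hmeas : ∀ i, Measurable (Z i)) (hindep : iIndepFun Z P)
    (hnn : ∀ i ω, 0 ≤ Z i ω) (hZint : ∀ i, Integrable (Z i) P) (hone : ∀ i, ∫ ω, Z i ω ∂P = 1)
    (N : ℕ) (c : ℝ) (hc : 0 < c) :
    P {ω | ∃ k ≤ N, c ≤ ∏ i ∈ Finset.range (k + 1), Z i ω} ≤ ENNReal.ofReal (1 / c) := by
  have hsm : ∀ i, StronglyMeasurable (Z i) := fun i => (hmeas i).stronglyMeasurable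
  let 𝒢 := Filtration.natural Z hsm
  let M : ℕ → Ω → ℝ := fun k ω => ∏ i ∈ Finset.range (k + 1), Z i ω
  have hMnn : 0 ≤ M := fun k ω => Finset.prod_nonneg fun i _ => hnn i ω
  have hadp : StronglyAdapted 𝒢 M := by
    intro k
    refine Finset.stronglyMeasurable_fun_prod _ fun i hi => ?_
    have := (Filtration.stronglyAdapted_natural hsm) i
    exact this.mono (𝒢.mono (by simp at hi; omega))
  have hsucc : ∀ k, M (k+1) = M k * Z (k+1) := by
    intro k; ext ω; simp [M, Finset.prod_range_succ _ (k+1)]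
  have hind : ∀ k, IndepFun (M k) (Z (k+1)) P := by
    intro k
    have := hindep.indepFun_finsetProd_of_notMem hmeas (s := Finset.range (k+1)) (i := k+1) (by simp)
    convert this using 1
    ext ω; simp [M]
  have hMint : ∀ k, Integrable (M k) P := by
    intro k
    induction k with
    | zero => simpa [M] using hZint 0
    | succ k ih => rw [hsucc]; exact (hind k).integrable_mul ih (hZint _)
  have hM1 : ∀ k, ∫ ω, M k ω ∂P = 1 := by
    intro k
    induction k with
    | zero => simpa [M] using hone 0
    | succ k ih =>
      rw [hsucc, (hind k).integral_mul_eq_mul_integral (hMint k).1 (hZint _).1, ih, hone, mul_one]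
  have hmart : Martingale M 𝒢 P := by
    refine martingale_nat hadp hMint fun k => ?_
    have h1 := condExp_mul_of_stronglyMeasurable_left (hadp k) (hsucc k ▸ hMint (k+1)) (hZint (k+1))
    have h2 := hindep.condExp_natural_ae_eq_of_lt hsm (Nat.lt_succ_self k)
    rw [hsucc]
    filter_upwards [h1, h2] with ω h1 h2
    rw [h1, Pi.mul_apply, h2, hone, mul_one]
  have hmax := maximal_ineq hmart.submartingale hMnn (ε := ⟨c, hc.le⟩) N
  have hset : {ω | ∃ k ≤ N, c ≤ ∏ i ∈ Finset.range (k + 1), Z i ω} ⊆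
      {ω | ((⟨c, hc.le⟩ : NNReal) : ℝ) ≤ (Finset.range (N + 1)).sup' Finset.nonempty_range_add_one fun k => M k ω} := by
    rintro ω ⟨k, hk, h⟩
    refine le_trans h ?_
    exact Finset.le_sup' (fun k => M k ω) (by simp; omega)
  refine (measure_mono hset).trans ?_
  set A := {ω | ((⟨c, hc.le⟩ : NNReal) : ℝ) ≤ (Finset.range (N + 1)).sup' Finset.nonempty_range_add_one fun k => M k ω}
  have hle : ENNReal.ofReal (∫ ω in A, M N ω ∂P) ≤ 1 := by
    rw [← ENNReal.ofReal_one]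
    apply ENNReal.ofReal_le_ofReal
    rw [← hM1 N]
    exact setIntegral_le_integral (hMint N) (Filter.Eventually.of_forall (hMnn N))
  have h3 := hmax.trans hle
  rw [one_div, ENNReal.ofReal_inv_of_pos hc]
  have h4 : ENNReal.ofNNReal (⟨c, hc.le⟩ : NNReal) = ENNReal.ofReal c :=
    (ENNReal.ofReal_eq_coe_nnreal hc.le).symm
  rw [h4] at h3
  rw [ENNReal.le_inv_iff_mul_le, mul_comm]
  exact h3

/-- Crossing of a line by the centered walk. -/
lemma line_cross {Ω : Type*} [MeasurableSpace Ω]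
    (P : Measure Ω) [IsProbabilityMeasure P]
    (X : ℕ → Ω → ℝ) (μ : ℝ) (hmeas : ∀ i, Measurable (X i))
    (hindep : iIndepFun X P)
    (hident : ∀ i, IdentDistrib (X i) (X 0) P P)
    (hrange : ∀ i, ∀ᵐ ω ∂P, X i ω ∈ Set.Icc (0:ℝ) 1)
    (hmean : ∫ ω, X 0 ω ∂P = μ) (l : ℝ) (hl : 0 < l) (N : ℕ) (c : ℝ) :
    P {ω | ∃ k ≤ N, c ≤ (∑ i ∈ Finset.range (k + 1), (μ - X i ω)) - ((k:ℝ) + 1) * l / 8}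
      ≤ ENNReal.ofReal (rexp (-(l * c))) := by
  have hm : ∀ i, ∫ ω, X i ω ∂P = μ := fun i => (hident i).integral_eq.trans hmean
  have hsg : ∀ i, HasSubgaussianMGF (fun ω => μ - X i ω) ((1/2)^2) P := by
    intro i
    have h := (hasSubgaussianMGF_of_mem_Icc (hmeas i).aemeasurable (hrange i)).neg
    rw [hm i] at h
    convert h using 1
    · ext ω; simp
    · simp
  let G : ℕ → ℝ := fun i => mgf (fun ω => μ - X i ω) P l
  have hGpos : ∀ i, 0 < G i := fun i => mgf_pos ((hsg i).integrable_exp_mul l)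
  have hGle : ∀ i, G i ≤ rexp (l^2/8) := by
    intro i
    refine ((hsg i).mgf_le l).trans (le_of_eq ?_)
    congr 1; push_cast; ring
  let Z : ℕ → Ω → ℝ := fun i ω => rexp (l * (μ - X i ω)) / G i
  have hZ := ville_prod P Z (fun i => by fun_prop)
    (hindep.comp (fun i x => rexp (l * (μ - x)) / G i) (fun i => by fun_prop))
    (fun i ω => div_nonneg (exp_nonneg _) (hGpos i).le)
    (fun i => ((hsg i).integrable_exp_mul l).div_const _)
    (fun i => by
      simp only [Z]
      rw [integral_div]
      exact div_self (hGpos i).ne') N (rexp (l * c)) (exp_pos _)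
  rw [one_div, ← exp_neg] at hZ
  refine le_trans (measure_mono ?_) hZ
  rintro ω ⟨k, hk, h⟩
  refine ⟨k, hk, ?_⟩
  have h1 : ∀ i ∈ Finset.range (k+1), rexp (l * (μ - X i ω) - l^2/8) ≤ Z i ω := by
    intro i _
    rw [exp_sub]
    exact div_le_div_of_nonneg_left (exp_nonneg _) (hGpos i) (hGle i)
  refine le_trans ?_ (Finset.prod_le_prod (fun i _ => exp_nonneg _) h1)
  rw [← exp_sum]
  apply exp_le_exp.2
  rw [Finset.sum_sub_distrib, ← Finset.mul_sum]
  simp only [Finset.sum_const, Finset.card_range, nsmul_eq_mul]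
  push_cast
  nlinarith [mul_le_mul_of_nonneg_left h hl.le]

lemma line_expect {Ω : Type*} [MeasurableSpace Ω]
    (P : Measure Ω) [IsProbabilityMeasure P]
    (X : ℕ → Ω → ℝ) (μ : ℝ) (hmeas : ∀ i, Measurable (X i))
    (hindep : iIndepFun X P)
    (hident : ∀ i, IdentDistrib (X i) (X 0) P P)
    (hrange : ∀ i, ∀ᵐ ω ∂P, X i ω ∈ Set.Icc (0:ℝ) 1)
    (hmean : ∫ ω, X 0 ω ∂P = μ) (l : ℝ) (hl : 0 < l) (x : ℝ) :
    ∫⁻ ω, ⨆ k : ℕ, ENNReal.ofReal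
      ((∑ i ∈ Finset.range (k + 1), (μ - X i ω)) - ((k:ℝ) + 1) * l / 8 - x) ∂P
      ≤ ENNReal.ofReal (rexp (-(l * x)) / l) := by
  let q : ℕ → Ω → ℝ := fun k ω =>
    (∑ i ∈ Finset.range (k + 1), (μ - X i ω)) - ((k:ℝ) + 1) * l / 8 - x
  have hq : ∀ k, Measurable (q k) := fun k => by fun_prop
  let F : ℕ → Ω → ℝ := fun N ω => (Finset.range (N+1)).sup' Finset.nonempty_range_add_one
    fun k => max (q k ω) 0
  have hF : ∀ N, Measurable (F N) := by
    intro N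
    exact Finset.measurable_range_sup'' fun k _ => (hq k).max measurable_const
  have hFnn : ∀ N ω, 0 ≤ F N ω := fun N ω =>
    (le_max_right (q 0 ω) 0).trans (Finset.le_sup' (fun k => max (q k ω) 0) (by simp))
  have hFmono : Monotone F := by
    intro a b hab ω
    apply Finset.sup'_mono
    intro i hi; simp at hi ⊢; omega
  have hsup : ∀ ω, ⨆ k : ℕ, ENNReal.ofReal (q k ω) ≤ ⨆ N, ENNReal.ofReal (F N ω) := by
    intro ω
    refine iSup_mono fun k => ENNReal.ofReal_le_ofReal ?_
    exact (le_max_left _ 0).trans (Finset.le_sup' (fun k => max (q k ω) 0) (by simp))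
  refine (lintegral_mono hsup).trans ?_
  rw [lintegral_iSup (fun N => (hF N).ennreal_ofReal)
    (fun a b hab ω => ENNReal.ofReal_le_ofReal (hFmono hab ω))]
  refine iSup_le fun N => ?_
  rw [lintegral_eq_lintegral_meas_lt P (Filter.Eventually.of_forall (hFnn N)) (hF N).aemeasurable]
  have hb : ∀ t ∈ Set.Ioi (0:ℝ), P {ω | t < F N ω} ≤
      ENNReal.ofReal (rexp (-(l * x)) * rexp (-l * t)) := by
    intro t ht
    have := line_cross P X μ hmeas hindep hident hrange hmean l hl N (x + t)
    rw [← exp_add, show -(l*x) + -l * t = -(l * (x+t)) by ring]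
    refine le_trans (measure_mono ?_) this
    intro ω hω
    simp only [Set.mem_ofPred_eq, F, Finset.lt_sup'_iff] at hω
    obtain ⟨k, hk, h⟩ := hω
    refine ⟨k, by simp at hk; omega, ?_⟩
    rcases lt_max_iff.1 h with h | h
    · simp only [q] at h; linarith
    · exact absurd h (not_lt.2 (le_of_lt ht))
  refine (setLIntegral_mono' measurableSet_Ioi hb).trans ?_
  rw [← ofReal_integral_eq_lintegral_ofReal]
  · apply ENNReal.ofReal_le_ofReal
    rw [integral_const_mul, integral_exp_mul_Ioi (by linarith)]
    simp [div_eq_mul_inv]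
  · exact (integrableOn_exp_mul_Ioi (by linarith) 0).const_mul _
  · exact Filter.Eventually.of_forall fun t => by positivity

lemma cover_expect {Ω : Type*} [MeasurableSpace Ω]
    (P : Measure Ω) [IsProbabilityMeasure P]
    (X : ℕ → Ω → ℝ) (μ : ℝ) (hmeas : ∀ i, Measurable (X i))
    (hindep : iIndepFun X P)
    (hident : ∀ i, IdentDistrib (X i) (X 0) P P)
    (hrange : ∀ i, ∀ᵐ ω ∂P, X i ω ∈ Set.Icc (0:ℝ) 1)
    (hmean : ∫ ω, X 0 ω ∂P = μ) (c : ℕ → ℝ) {ι : Type} [Countable ι]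
    (m x l : ι → ℝ) (hm : ∀ j, 0 < m j) (hl : ∀ j, 0 < l j)
    (hcov : ∀ n : ℕ, ∃ j, m j ≤ (n:ℝ) + 1 ∧ x j ≤ ((n:ℝ)+1) * c n - ((n:ℝ)+1) * l j / 8) :
    ∫⁻ ω, ENNReal.ofReal (⨆ n : ℕ,
        (μ - (∑ i ∈ Finset.range (n + 1), X i ω) / (n + 1 : ℕ) - c n)) ∂P
      ≤ ∑' j, ENNReal.ofReal (rexp (-(l j * x j)) / (l j * m j)) := by
  let W : ι → Ω → ℝ≥0∞ := fun j ω => ⨆ k : ℕ, ENNReal.ofReal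
      ((∑ i ∈ Finset.range (k + 1), (μ - X i ω)) - ((k:ℝ) + 1) * l j / 8 - x j)
  have hW : ∀ j, Measurable (W j) := fun j => Measurable.iSup fun k => by fun_prop
  have key : ∀ ω, ENNReal.ofReal (⨆ n : ℕ,
        (μ - (∑ i ∈ Finset.range (n + 1), X i ω) / (n + 1 : ℕ) - c n)) ≤
        ∑' j, ENNReal.ofReal (1 / m j) * W j ω := by
    intro ω
    have h1 : ∀ n : ℕ, ENNReal.ofReal
        (μ - (∑ i ∈ Finset.range (n + 1), X i ω) / (n + 1 : ℕ) - c n) ≤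
        ∑' j, ENNReal.ofReal (1 / m j) * W j ω := by
      intro n
      obtain ⟨j, hj1, hj2⟩ := hcov n
      refine le_trans ?_ (ENNReal.le_tsum j)
      refine le_trans ?_ (mul_le_mul_right (le_iSup _ n) _)
      rw [← ENNReal.ofReal_mul (by have := hm j; positivity)]
      rcases le_or_gt (μ - (∑ i ∈ Finset.range (n + 1), X i ω) / (n + 1 : ℕ) - c n) 0 with h | h
      · rw [ENNReal.ofReal_of_nonpos h]; exact zero_le
      apply ENNReal.ofReal_le_ofReal
      rw [Finset.sum_sub_distrib]
      simp only [Finset.sum_const, Finset.card_range, nsmul_eq_mul]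
      set S := ∑ i ∈ Finset.range (n + 1), X i ω
      push_cast at h ⊢
      have hn : (0:ℝ) < (n:ℝ) + 1 := by positivity
      have e : (μ - S / ((n:ℝ)+1) - c n) * ((n:ℝ)+1) = ((n:ℝ)+1) * μ - S - ((n:ℝ)+1) * c n := by
        field_simp
      rw [one_div_mul_eq_div, le_div_iff₀ (hm j)]
      have := mul_le_mul_of_nonneg_left hj1 h.le
      linarith
    set B := ∑' j, ENNReal.ofReal (1 / m j) * W j ω
    by_cases hB : B = ⊤
    · rw [hB]; exact le_top
    · rw [ENNReal.ofReal_le_iff_le_toReal hB]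
      refine Real.iSup_le (fun n => ?_) ENNReal.toReal_nonneg
      exact (ENNReal.ofReal_le_iff_le_toReal hB).1 (h1 n)
  refine (lintegral_mono key).trans ?_
  rw [lintegral_tsum (fun j => ((hW j).const_mul _).aemeasurable)]
  refine ENNReal.tsum_le_tsum fun j => ?_
  rw [lintegral_const_mul _ (hW j)]
  refine (mul_le_mul_right (line_expect P X μ hmeas hindep hident hrange hmean (l j) (hl j) (x j)) _).trans ?_
  rw [← ENNReal.ofReal_mul (by have := hm j; positivity)]
  apply le_of_eq; congr 1
  have := hm j; have := hl j
  field_simp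

lemma block_B (T n L : ℝ) (k : ℕ) (hT : 0 < T) (hn : 0 < n)
    (h1 : T / (4 * (2^(k+1))^2) ≤ n) (h2 : n ≤ T / (2^(k+1))^2)
    (hL : Real.log (T / n) ≤ L) (l : ℝ)
    (hl : l = 4 * √2 / 3 * √(2 * (k + 1) * Real.log 2) * (2 * 2^(k+1)) / √T) :
    3 / 4 * (2 * (k + 1) * Real.log 2) / l ≤ n * √(1 / (2 * n) * L) - n * l / 8 := by
  set b : ℝ := 2^(k+1) with hb
  have hb0 : 0 < b := by positivity
  have hlog2 : 0 < Real.log 2 := Real.log_pos (by norm_num)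
  set ℓ : ℝ := 2 * (k + 1) * Real.log 2 with hℓ
  have hℓ0 : 0 < ℓ := by positivity
  have hbl : Real.log (b^2) = ℓ := by
    rw [Real.log_pow, hb, Real.log_pow, hℓ]; push_cast; ring
  have hLℓ : ℓ ≤ L := by
    refine le_trans ?_ hL
    rw [← hbl]
    apply Real.log_le_log (by positivity)
    rw [le_div_iff₀ hn]
    rw [le_div_iff₀ (by positivity)] at h2
    linarith
  have hR0 : 0 < √T := Real.sqrt_pos.2 hT
  have hR : √T * √T = T := Real.mul_self_sqrt hT.le
  have hp0 : 0 < √n := Real.sqrt_pos.2 hn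
  have hp : √n * √n = n := Real.mul_self_sqrt hn.le
  have hq0 : 0 < √ℓ := Real.sqrt_pos.2 hℓ0
  have hq : √ℓ * √ℓ = ℓ := Real.mul_self_sqrt hℓ0.le
  have ht0 : 0 < √2 := Real.sqrt_pos.2 (by norm_num)
  have ht : √2 * √2 = 2 := Real.mul_self_sqrt (by norm_num)
  have hl0 : 0 < l := by rw [hl]; positivity
  have hc : √n * √ℓ / √2 ≤ n * √(1 / (2 * n) * L) := by
    have e : √(1 / (2*n) * ℓ) = √ℓ / (√2 * √n) := by
      rw [one_div_mul_eq_div, Real.sqrt_div hℓ0.le, Real.sqrt_mul (x := 2) (by norm_num) n]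
    calc √n * √ℓ / √2 = n * √(1 / (2 * n) * ℓ) := by
          rw [e]; nth_rw 2 [← hp]; field_simp
      _ ≤ _ := by gcongr
  refine le_trans ?_ (sub_le_sub_right hc _)
  rw [div_le_iff₀ hl0]
  set s : ℝ := 2 * b * √n / √T with hs
  have hs0 : 0 < s := by positivity
  have hs2 : s^2 = 4 * b^2 * n / T := by
    rw [hs, div_pow, mul_pow, Real.sq_sqrt hn.le, Real.sq_sqrt hT.le]; ring
  have hs_ge : 1 ≤ s := by
    have : 1 ≤ s^2 := by
      rw [hs2, le_div_iff₀ hT]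
      rw [div_le_iff₀ (by positivity)] at h1
      linarith
    nlinarith
  have hs_le : s ≤ 2 := by
    have : s^2 ≤ 4 := by
      rw [hs2, div_le_iff₀ hT]
      rw [le_div_iff₀ (by positivity)] at h2
      linarith
    nlinarith
  have e1 : √n * √ℓ / √2 * l = 4/3 * ℓ * s := by
    rw [hl, hs]; nth_rw 3 [← hq]; field_simp
  have e2 : n * l / 8 * l = 4/9 * ℓ * s^2 := by
    rw [hs2, hl]
    have : n * (4 * √2 / 3 * √ℓ * (2 * b) / √T) / 8 * (4 * √2 / 3 * √ℓ * (2 * b) / √T)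
      = n * (16 * (√2*√2) / 9 * (√ℓ*√ℓ) * (4 * b^2)) / (√T*√T) / 8 := by field_simp; ring
    rw [this, ht, hq, hR]; field_simp; ring
  rw [sub_mul, e1, e2]
  nlinarith [mul_nonneg hℓ0.le (mul_nonneg (sub_nonneg.2 hs_ge) (sub_nonneg.2 hs_le))]

lemma term_B (T : ℝ) (k : ℕ) (hT : 0 < T) (l m : ℝ)
    (hl : l = 4 * √2 / 3 * √(2 * (k + 1) * Real.log 2) * (2 * 2^(k+1)) / √T)
    (hm : m = T / (4 * (2^(k+1))^2)) :
    rexp (-(l * (3 / 4 * (2 * (k + 1) * Real.log 2) / l))) / (l * m) ≤ 1 / √T * (3/4)^k := by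
  have hlog2 : 0.69 < Real.log 2 := by have := Real.log_two_gt_d9; linarith
  have hlog20 : 0 < Real.log 2 := by linarith
  have hR0 : 0 < √T := Real.sqrt_pos.2 hT
  have hR : √T * √T = T := Real.mul_self_sqrt hT.le
  have hl1 : 1 ≤ √(2 * (k + 1) * Real.log 2) := by
    rw [Real.one_le_sqrt]
    have : (0:ℝ) ≤ k := by positivity
    nlinarith
  have ht1 : (1.4:ℝ) ≤ √2 := by
    apply Real.le_sqrt_of_sq_le; norm_num
  have hl0 : 0 < l := by rw [hl]; positivity
  rw [mul_div_cancel₀ _ hl0.ne']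
  have hlm : 14/15 / 2^(k+1) * √T ≤ l * m := by
    have : l * m = 2 / 3 * √2 * √(2 * (k + 1) * Real.log 2) / 2^(k+1) * √T := by
      rw [hl, hm]; nth_rw 2 [← hR]; field_simp
    rw [this]
    gcongr
    nlinarith
  have he : rexp (-(3 / 4 * (2 * (k + 1) * Real.log 2))) ≤ (3/8)^(k+1) := by
    have : -(3 / 4 * (2 * (k + 1) * Real.log 2)) = ((k+1 : ℕ):ℝ) * (-(3/2 * Real.log 2)) := by
      push_cast; ring
    rw [this, Real.exp_nat_mul]
    gcongr
    have h2 : rexp (-(3/2 * Real.log 2))^2 = 1/8 := by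
      rw [← Real.exp_nat_mul, show ((2:ℕ):ℝ) * (-(3/2 * Real.log 2)) = -(((3:ℕ):ℝ) * Real.log 2) by push_cast; ring,
        Real.exp_neg, Real.exp_nat_mul, Real.exp_log (by norm_num)]; norm_num
    nlinarith [Real.exp_pos (-(3/2 * Real.log 2))]
  calc _ ≤ (3/8)^(k+1) / (14/15 / 2^(k+1) * √T) := by gcongr
    _ = (15/14 * (3/4)) * (1 / √T * (3/4)^k) := by
        have : (3/8 : ℝ)^(k+1) = (3/4)^k * (3/4) / 2^(k+1) := by
          rw [← pow_succ, ← div_pow]; norm_num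
        rw [this]; field_simp
    _ ≤ 1 * (1 / √T * (3/4)^k) := by gcongr; norm_num
    _ = _ := one_mul _

lemma term_A (T : ℝ) (k : ℕ) (hT : 0 < T) :
    rexp (-(2 / (√T * 2^k) * (-(√T * 2^k / 4)))) / (2 / (√T * 2^k) * (T * (2^k)^2 / 4)) ≤
      7/2 / √T * (1/2)^k := by
  have hR0 : 0 < √T := Real.sqrt_pos.2 hT
  have hR : √T * √T = T := Real.mul_self_sqrt hT.le
  have e1 : -(2 / (√T * 2^k) * (-(√T * 2^k / 4))) = 1/2 := by field_simp; norm_num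
  have e2 : (2 / (√T * 2^k) * (T * (2^k)^2 / 4)) = √T * 2^k / 2 := by
    nth_rw 2 [← hR]; field_simp; norm_num
  have he : rexp (1/2) ≤ 7/4 := by
    have h2 : rexp (1/2)^2 = rexp 1 := by
      rw [← Real.exp_nat_mul]; norm_num
    have := Real.exp_one_lt_d9
    nlinarith [Real.exp_pos (1/2)]
  rw [e1, e2]
  calc _ ≤ 7/4 / (√T * 2^k / 2) := by gcongr
    _ = _ := by rw [one_div, inv_pow]; field_simp; norm_num

/-- Control of the left deviations of the MOSS-type index: for i.i.d. random variables
`X_1, X_2, …` with values in `[0,1]` and mean `μ`, for all integers `K ≥ 1` and `τ ≥ K`,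
`E[sup_{n ≥ 1} (μ − μ̂_n − √((1/(2n)) ln₊(τ/(Kn))))⁺] ≤ 20 √(π/8) √(K/τ)`. -/
theorem index_left_deviations {Ω : Type*} [MeasurableSpace Ω]
    (P : Measure Ω) [IsProbabilityMeasure P]
    (X : ℕ → Ω → ℝ) (μ : ℝ) (hmeas : ∀ i, Measurable (X i))
    (hindep : iIndepFun X P)
    (hident : ∀ i, IdentDistrib (X i) (X 0) P P)
    (hrange : ∀ i, ∀ᵐ ω ∂P, X i ω ∈ Set.Icc (0:ℝ) 1)
    (hmean : ∫ ω, X 0 ω ∂P = μ)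
    (K τ : ℕ) (hK : 1 ≤ K) (hτ : K ≤ τ) :
    ∫⁻ ω, ENNReal.ofReal (⨆ n : ℕ,
        (μ - (∑ i ∈ Finset.range (n + 1), X i ω) / (n + 1 : ℕ) -
          Real.sqrt (1 / (2 * ((n : ℝ) + 1)) *
            max (Real.log ((τ : ℝ) / (K * ((n : ℝ) + 1)))) 0))) ∂P
      ≤ ENNReal.ofReal (20 * Real.sqrt (π / 8) * Real.sqrt ((K : ℝ) / τ)) := by
  have hK0 : (0:ℝ) < K := by exact_mod_cast hK
  have hτ0 : (0:ℝ) < τ := by exact_mod_cast (lt_of_lt_of_le hK hτ)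
  set T : ℝ := (τ:ℝ) / K with hTdef
  have hT : 0 < T := by positivity
  have hR0 : 0 < √T := Real.sqrt_pos.2 hT
  have hlog20 : 0 < Real.log 2 := Real.log_pos (by norm_num)
  let lA : ℕ → ℝ := fun k => 2 / (√T * 2^k)
  let lB : ℕ → ℝ := fun k => 4 * √2 / 3 * √(2 * (k + 1) * Real.log 2) * (2 * 2^(k+1)) / √T
  let m : ℕ ⊕ ℕ → ℝ := Sum.elim (fun k => T * (2^k)^2 / 4) (fun k => T / (4 * (2^(k+1))^2))
  let l : ℕ ⊕ ℕ → ℝ := Sum.elim lA lB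
  let x : ℕ ⊕ ℕ → ℝ := Sum.elim (fun k => -(√T * 2^k / 4))
    (fun k => 3 / 4 * (2 * (k + 1) * Real.log 2) / lB k)
  have hmain := cover_expect P X μ hmeas hindep hident hrange hmean
    (fun n => Real.sqrt (1 / (2 * ((n : ℝ) + 1)) *
            max (Real.log ((τ : ℝ) / (K * ((n : ℝ) + 1)))) 0)) m x l
    (by rintro (k | k) <;> simp only [m, Sum.elim_inl, Sum.elim_inr] <;> positivity)
    (by rintro (k | k) <;> simp only [l, lA, lB, Sum.elim_inl, Sum.elim_inr] <;> positivity)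
    (by
      intro n
      have hn : (0:ℝ) < (n:ℝ) + 1 := by positivity
      have hTn : (τ : ℝ) / (K * ((n : ℝ) + 1)) = T / ((n:ℝ)+1) := by
        rw [hTdef, div_div]
      rw [hTn]
      set y : ℝ := (n:ℝ) + 1
      have h4 : ∀ k : ℕ, ((2:ℝ)^k)^2 = 4^k := fun k => by rw [← pow_mul, mul_comm, pow_mul]; norm_num
      rcases le_or_gt T (4 * y) with h | h
      · obtain ⟨k, hk1, hk2⟩ := exists_nat_pow_near (x := 4 * y / T) (y := 4)
          (by rw [le_div_iff₀ hT]; linarith) (by norm_num)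
        rw [le_div_iff₀ hT] at hk1
        rw [div_lt_iff₀ hT, pow_succ] at hk2
        refine ⟨Sum.inl k, ?_, ?_⟩
        · simp only [m, Sum.elim_inl, h4]; linarith
        · simp only [x, l, lA, Sum.elim_inl]
          have hc : 0 ≤ y * √(1 / (2 * y) * max (Real.log (T / y)) 0) := by positivity
          have : y * (2 / (√T * 2^k)) / 8 ≤ √T * 2^k / 4 := by
            rw [← mul_div_assoc, div_div, div_le_iff₀ (by positivity)]
            have e : √T * 2^k / 4 * (√T * 2^k * 8) = 2 * ((√T)^2 * (2^k)^2) := by ring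
            rw [e, Real.sq_sqrt hT.le, h4]; linarith
          linarith
      · obtain ⟨k, hk1, hk2⟩ := exists_nat_pow_near (x := T / (4 * y)) (y := 4)
          (by rw [le_div_iff₀ (by positivity)]; linarith) (by norm_num)
        rw [le_div_iff₀ (by positivity)] at hk1
        rw [div_lt_iff₀ (by positivity)] at hk2
        have hB1 : T / (4 * (2^(k+1))^2) ≤ y := by
          rw [div_le_iff₀ (by positivity), h4]; linarith
        have hB2 : y ≤ T / (2^(k+1))^2 := by
          rw [le_div_iff₀ (by positivity), h4, pow_succ]; linarith
        refine ⟨Sum.inr k, hB1, ?_⟩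
        exact block_B T y _ k hT hn hB1 hB2 (le_max_left _ _) (lB k) rfl)
  refine hmain.trans ?_
  have hA : HasSum (fun k : ℕ => 7/2 / √T * (1/2:ℝ)^k) (7 / √T) := by
    have := (hasSum_geometric_of_lt_one (r := (1/2:ℝ)) (by norm_num) (by norm_num)).mul_left (7/2 / √T)
    rwa [show 7/2 / √T * ((1:ℝ)-1/2)⁻¹ = 7 / √T by norm_num; ring] at this
  have hB : HasSum (fun k : ℕ => 1 / √T * (3/4:ℝ)^k) (4 / √T) := by
    have := (hasSum_geometric_of_lt_one (r := (3/4:ℝ)) (by norm_num) (by norm_num)).mul_left (1 / √T)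
    rwa [show 1 / √T * ((1:ℝ)-3/4)⁻¹ = 4 / √T by norm_num; ring] at this
  rw [Summable.tsum_sum ENNReal.summable ENNReal.summable]
  have hA' : ∑' k : ℕ, ENNReal.ofReal (rexp (-(l (Sum.inl k) * x (Sum.inl k))) /
      (l (Sum.inl k) * m (Sum.inl k))) ≤ ENNReal.ofReal (7 / √T) := by
    rw [← hA.tsum_eq, ENNReal.ofReal_tsum_of_nonneg (fun k => by positivity) hA.summable]
    exact ENNReal.tsum_le_tsum fun k => ENNReal.ofReal_le_ofReal (term_A T k hT)
  have hB' : ∑' k : ℕ, ENNReal.ofReal (rexp (-(l (Sum.inr k) * x (Sum.inr k))) /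
      (l (Sum.inr k) * m (Sum.inr k))) ≤ ENNReal.ofReal (4 / √T) := by
    rw [← hB.tsum_eq, ENNReal.ofReal_tsum_of_nonneg (fun k => by positivity) hB.summable]
    exact ENNReal.tsum_le_tsum fun k => ENNReal.ofReal_le_ofReal (term_B T k hT (lB k) _ rfl rfl)
  refine (add_le_add hA' hB').trans ?_
  rw [← ENNReal.ofReal_add (by positivity) (by positivity)]
  apply ENNReal.ofReal_le_ofReal
  have e : √((K:ℝ)/τ) = 1 / √T := by
    rw [show (K:ℝ)/τ = T⁻¹ by rw [hTdef, inv_div], Real.sqrt_inv, one_div]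
  have hpi : 0.6 ≤ √(π / 8) := by
    apply Real.le_sqrt_of_sq_le
    have := Real.pi_gt_three
    linarith
  rw [e, ← add_div, ← mul_one_div (7+4)]
  have : 0 < 1 / √T := by positivity
  nlinarith
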